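/- Let Q ⊆ D ⊆ B and let g be an envy-free social choice function on D^N. Then for every true preference profile u (continuous, money-monotone, satisfying compensation), every limit Nash equilibrium outcome of the complete-information direct revelation game (N, D^N, g, u) is an envy-free allocation for the true profile u. -/

import Mathlib

/-- Quasi-linear utility functions over prices and `n` rooms. -/
def QLset (n : ℕ) : Set (ℝ → Fin n → ℝ) :=
  {f | ∃ w : Fin n → ℝ, ∀ p a, f p a = w a - p}

/-- Budget-constrained quasi-linear utility functions with budget violation
index at most `ρbar`. -/
def Bset (n : ℕ) (ρbar : ℝ) : Set (ℝ → Fin n → ℝ) :=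
  {f | ∃ (w : Fin n → ℝ) (bb rr : ℝ), 0 ≤ bb ∧ 0 ≤ rr ∧ rr ≤ ρbar ∧
    ∀ p a, f p a = w a - p - rr * max 0 (p - bb)}

/-- Envy-freeness of the allocation `(r, σ)` for a utility profile. -/
def EnvyFree (n : ℕ) (u : Fin n → ℝ → Fin n → ℝ) (r : Fin n → ℝ)
    (σ : Equiv.Perm (Fin n)) : Prop :=
  ∀ i j : Fin n, u i (r (σ j)) (σ j) ≤ u i (r (σ i)) (σ i)


/-- slopes between 1 and lam -/
def SlopeB {J A : Type} (lam : ℝ) (v : J → ℝ → A → ℝ) : Prop :=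
  ∀ j a p q, p ≤ q → v j q a + (q - p) ≤ v j p a ∧ v j p a ≤ v j q a + lam * (q - p)

/-- room a is demanded by j at r -/
def Dem {J A : Type} (v : J → ℝ → A → ℝ) (j : J) (r : A → ℝ) (a : A) : Prop :=
  ∀ b, v j (r b) b ≤ v j (r a) a

open Classical in
/-- Hall surplus condition -/
def Sol {J A : Type} [Fintype J] [Fintype A] (v : J → ℝ → A → ℝ) (r : A → ℝ) : Prop :=
  ∀ S : Finset J, S.Nonempty →
    S.card + 1 ≤ (Finset.univ.filter (fun a => ∃ j ∈ S, Dem v j r a)).card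

open Classical in
/-- every set of rooms avoiding e is demanded by enough agents -/
def DemE {J A : Type} [Fintype J] [Fintype A] (v : J → ℝ → A → ℝ) (r : A → ℝ) (e : A) : Prop :=
  ∀ L : Finset A, e ∉ L →
    L.card ≤ (Finset.univ.filter (fun j => ∃ a ∈ L, Dem v j r a)).card

theorem sol_demE {J A : Type} [Fintype J] [Fintype A] (v : J → ℝ → A → ℝ) (r : A → ℝ)
    (hc : Fintype.card A = Fintype.card J + 1) (h : Sol v r) (e : A) : DemE v r e := by
  classical
  intro L he
  have h1 := Finset.card_filter_add_card_filter_not (s := (Finset.univ : Finset J))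
    (fun j => ∃ a ∈ L, Dem v j r a)
  set S := Finset.univ.filter (fun j => ¬ ∃ a ∈ L, Dem v j r a) with hS
  have hLc : L.card + Lᶜ.card = Fintype.card A := Finset.card_add_card_compl L
  have hJ : (Finset.univ : Finset J).card = Fintype.card J := Finset.card_univ
  rcases S.eq_empty_or_nonempty with h0 | h0
  · rw [h0] at h1
    have : 0 < Lᶜ.card := Finset.card_pos.2 ⟨e, by simpa using he⟩
    simp only [Finset.card_empty] at h1
    omega
  · have h2 := h S h0
    have h3 : (Finset.univ.filter (fun a => ∃ j ∈ S, Dem v j r a)).card ≤ Lᶜ.card := by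
      apply Finset.card_le_card
      intro a ha
      simp only [hS, Finset.mem_filter, Finset.mem_univ, true_and] at ha
      obtain ⟨j, hj, hd⟩ := ha
      rw [Finset.mem_compl]
      exact fun hL => hj ⟨a, hL, hd⟩
    omega

theorem level {J A : Type} [Fintype J] [Fintype A] (v : J → ℝ → A → ℝ) (lam : ℝ)
    (hl : 1 ≤ lam) (hv : SlopeB lam v) (r rs : A → ℝ) (e a : A)
    (hs : Sol v rs) (hr : DemE v r e) :
    r a - rs a ≤ lam ^ (Fintype.card A) * max 0 (r e - rs e) := by
  classical
  by_cases hx : r a - rs a ≤ 0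
  · exact hx.trans (by positivity)
  push Not at hx
  have key : ∀ s : ℕ, (r a - rs a ≤ lam ^ s * (r e - rs e)) ∨
      s + 1 ≤ (Finset.univ.filter (fun b => r a - rs a ≤ lam ^ s * (r b - rs b))).card := by
    intro s
    induction s with
    | zero =>
      right
      apply Finset.card_pos.2
      exact ⟨a, by simp⟩
    | succ s ih =>
      have pos : ∀ b, r a - rs a ≤ lam ^ s * (r b - rs b) → 0 < r b - rs b := by
        intro b hb
        by_contra hcon
        push Not at hcon
        have : lam ^ s * (r b - rs b) ≤ 0 := mul_nonpos_of_nonneg_of_nonpos (by positivity) hcon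
        linarith
      have hls : 0 ≤ lam ^ s := by positivity
      by_cases he : r a - rs a ≤ lam ^ s * (r e - rs e)
      · left
        have := pos e he
        rw [pow_succ]
        nlinarith [mul_nonneg hls this.le]
      · right
        have hcard := ih.resolve_left he
        set L := Finset.univ.filter (fun b => r a - rs a ≤ lam ^ s * (r b - rs b)) with hL
        have h1 := hr L (by simpa [hL] using he)
        have h2 := hs (Finset.univ.filter (fun j => ∃ a ∈ L, Dem v j r a))
          (Finset.card_pos.1 (by omega))
        refine le_trans (by omega) (h2.trans (Finset.card_le_card ?_))
        intro c hc
        simp only [hL, Finset.mem_filter, Finset.mem_univ, true_and] at hc ⊢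
        obtain ⟨j, ⟨b, hb, hd⟩, hd2⟩ := hc
        have hbp := pos b hb
        have e1 := hd c
        have e2 := hd2 b
        have e3 := (hv j b (rs b) (r b) (by linarith)).1
        have hlt : rs c ≤ r c := by
          by_contra hcon
          push Not at hcon
          have := (hv j c (r c) (rs c) hcon.le).1
          linarith
        have e4 := (hv j c (rs c) (r c) hlt).2
        have e5 : r b - rs b ≤ lam * (r c - rs c) := by linarith
        rw [pow_succ, mul_assoc]
        exact hb.trans (mul_le_mul_of_nonneg_left e5 hls)
  rcases key (Fintype.card A) with h | h
  · exact h.trans (mul_le_mul_of_nonneg_left (le_max_right _ _) (by positivity))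
  · have := Finset.card_le_univ
      (Finset.univ.filter (fun b => r a - rs a ≤ lam ^ (Fintype.card A) * (r b - rs b)))
    omega

/-- auction states -/
def AState {J A : Type} (v : J → ℝ → A → ℝ) (s ε : ℝ) (k : A → ℕ)
    (S : Finset J) (f : J → A) : Prop :=
  (∀ j ∈ S, ∀ b, v j (s + ε * k b + ε) b ≤ v j (s + ε * k (f j)) (f j)) ∧
  (Set.InjOn f S) ∧ (∀ a, 0 < k a → ∃ j ∈ S, f j = a)

theorem auction {J A : Type} [Fintype J] [Fintype A] [Nonempty A] (v : J → ℝ → A → ℝ) (lam : ℝ)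
    (hv : SlopeB lam v) (hc : Fintype.card J = Fintype.card A)
    (s ε : ℝ) (hε : 0 < ε) :
    ∃ (k : A → ℕ) (f : J → A), AState v s ε k Finset.univ f ∧ ∃ a, k a = 0 := by
  classical
  have unm : ∀ (k : A → ℕ) (S : Finset J) (f : J → A), AState v s ε k S f → S ≠ Finset.univ →
      ∃ a, k a = 0 := by
    intro k S f h hS
    by_contra hcon
    push Not at hcon
    have : (Finset.univ : Finset A) ⊆ S.image f := by
      intro a _
      obtain ⟨j, hj, rfl⟩ := h.2.2 a (Nat.pos_of_ne_zero (hcon a))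
      exact Finset.mem_image_of_mem f hj
    have h1 := Finset.card_le_card this
    have h2 := Finset.card_image_le (s := S) (f := f)
    have h3 : S.card < Fintype.card J := by
      rw [Finset.card_lt_iff_ne_univ]; exact hS
    rw [Finset.card_univ] at h1
    omega
  by_contra hno
  push Not at hno
  have step : ∀ M : ℕ, ∃ (k : A → ℕ) (S : Finset J) (f : J → A), AState v s ε k S f ∧
      S ≠ Finset.univ ∧ M ≤ (∑ a, k a) * (Fintype.card J + 1) + S.card := by
    intro M
    induction M with
    | zero =>
      refine ⟨fun _ => 0, ∅, fun _ => Classical.arbitrary A, ⟨by simp, by simp, by simp⟩, ?_, by simp⟩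
      intro h
      have : Fintype.card J = 0 := by rw [← Finset.card_univ, ← h]; rfl
      have := Fintype.card_pos (α := A)
      omega
    | succ M ih =>
      obtain ⟨k, S, f, hst, hS, hM⟩ := ih
      have hSlt : S.card < Fintype.card J := by
        rw [Finset.card_lt_iff_ne_univ]; exact hS
      obtain ⟨a0, ha0⟩ := unm k S f hst hS
      obtain ⟨j, hj⟩ : ∃ j, j ∉ S := by
        by_contra hcon
        push Not at hcon
        exact hS (Finset.eq_univ_iff_forall.2 hcon)
      obtain ⟨a, ha⟩ := Finite.exists_max (fun b => v j (s + ε * k b + ε) b)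
      obtain ⟨h1, h2, h3⟩ := hst
      have anti : ∀ j b p q, p ≤ q → v j q b ≤ v j p b := by
        intro j b p q hpq
        have := (hv j b p q hpq).1
        linarith
      by_cases hm : ∃ j' ∈ S, f j' = a
      · obtain ⟨j', hj', hfj'⟩ := hm
        have hne : ∀ x ∈ S.erase j', f x ≠ a := by
          intro x hx hfx
          rw [Finset.mem_erase] at hx
          exact hx.1 (h2 hx.2 hj' (hfx.trans hfj'.symm))
        have hxj : ∀ x ∈ S.erase j', x ≠ j := by
          rintro x hx rfl
          exact hj (Finset.mem_of_mem_erase hx)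
        have hjn : j ∉ S.erase j' := fun h => hj (Finset.mem_of_mem_erase h)
        have hcard : (insert j (S.erase j')).card = S.card := by
          rw [Finset.card_insert_of_notMem hjn, Finset.card_erase_of_mem hj']
          have : 0 < S.card := Finset.card_pos.2 ⟨_, hj'⟩
          omega
        refine ⟨Function.update k a (k a + 1), insert j (S.erase j'), Function.update f j a,
          ⟨?_, ?_, ?_⟩, ?_, ?_⟩
        · have mono : ∀ j b, v j (s + ε * (Function.update k a (k a + 1) b : ℕ) + ε) b ≤
              v j (s + ε * k b + ε) b := by
            intro j b
            apply anti
            by_cases hb : b = a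
            · subst hb
              simp only [Function.update_self]
              push_cast
              nlinarith
            · rw [Function.update_of_ne hb]
          intro x hx b
          refine (mono x b).trans ?_
          rw [Finset.mem_insert] at hx
          rcases hx with rfl | hx
          · simp only [Function.update_self]
            refine (ha b).trans (le_of_eq ?_)
            push_cast
            ring_nf
          · rw [Function.update_of_ne (hxj x hx), Function.update_of_ne (hne x hx)]
            exact h1 x (Finset.mem_of_mem_erase hx) b
        · intro x hx y hy hxy
          simp only [Finset.coe_insert, Set.mem_insert_iff, Finset.mem_coe] at hx hy
          rcases hx with rfl | hx <;> rcases hy with rfl | hy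
          · rfl
          · rw [Function.update_self, Function.update_of_ne (hxj y hy)] at hxy
            exact absurd hxy.symm (hne y hy)
          · rw [Function.update_self, Function.update_of_ne (hxj x hx)] at hxy
            exact absurd hxy (hne x hx)
          · rw [Function.update_of_ne (hxj x hx), Function.update_of_ne (hxj y hy)] at hxy
            exact h2 (Finset.mem_of_mem_erase hx) (Finset.mem_of_mem_erase hy) hxy
        · intro b hb
          by_cases hba : b = a
          · exact ⟨j, Finset.mem_insert_self _ _, by rw [Function.update_self, hba]⟩
          · rw [Function.update_of_ne hba] at hb
            obtain ⟨x, hx, hfx⟩ := h3 b hb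
            have hx' : x ∈ S.erase j' := by
              rw [Finset.mem_erase]
              refine ⟨?_, hx⟩
              rintro rfl
              exact hba (hfx.symm.trans hfj')
            exact ⟨x, Finset.mem_insert_of_mem hx', by rw [Function.update_of_ne (hxj x hx'), hfx]⟩
        · intro h
          rw [h, Finset.card_univ] at hcard
          omega
        · rw [hcard, Finset.sum_update_of_mem (Finset.mem_univ a)]
          have e1 : ∑ x, k x = k a + ∑ x ∈ Finset.univ \ {a}, k x := by
            rw [← Finset.add_sum_erase _ _ (Finset.mem_univ a), Finset.sdiff_singleton_eq_erase]
          rw [e1] at hM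
          nlinarith
      · push Not at hm
        have hxj : ∀ x ∈ S, x ≠ j := by
          rintro x hx rfl
          exact hj hx
        have hk0 : k a = 0 := by
          by_contra hcon
          obtain ⟨x, hx, hfx⟩ := h3 a (Nat.pos_of_ne_zero hcon)
          exact hm x hx hfx
        have hnew : AState v s ε k (insert j S) (Function.update f j a) := by
          refine ⟨?_, ?_, ?_⟩
          · intro x hx b
            rw [Finset.mem_insert] at hx
            rcases hx with rfl | hx
            · simp only [Function.update_self]
              exact (ha b).trans (anti _ _ _ _ (by linarith))
            · rw [Function.update_of_ne (hxj x hx)]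
              exact h1 x hx b
          · intro x hx y hy hxy
            simp only [Finset.coe_insert, Set.mem_insert_iff, Finset.mem_coe] at hx hy
            rcases hx with rfl | hx <;> rcases hy with rfl | hy
            · rfl
            · rw [Function.update_self, Function.update_of_ne (hxj y hy)] at hxy
              exact absurd hxy.symm (hm y hy)
            · rw [Function.update_self, Function.update_of_ne (hxj x hx)] at hxy
              exact absurd hxy (hm x hx)
            · rw [Function.update_of_ne (hxj x hx), Function.update_of_ne (hxj y hy)] at hxy
              exact h2 hx hy hxy
          · intro b hb
            obtain ⟨x, hx, hfx⟩ := h3 b hb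
            exact ⟨x, Finset.mem_insert_of_mem hx, by rw [Function.update_of_ne (hxj x hx), hfx]⟩
        refine ⟨k, insert j S, Function.update f j a, hnew, ?_, ?_⟩
        · intro h
          rw [h] at hnew
          exact hno k _ hnew a hk0
        · rw [Finset.card_insert_of_notMem hj]
          omega
  -- boundedness
  have hbd : ∃ K : ℕ, ∀ (k : A → ℕ) (S : Finset J) (f : J → A), AState v s ε k S f →
      S ≠ Finset.univ → ∀ a, k a ≤ K := by
    obtain ⟨W, hW⟩ : ∃ W : ℝ, ∀ x : J × A × A, v x.1 s x.2.1 - v x.1 (s + ε) x.2.2 ≤ W := by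
      obtain ⟨W, hW⟩ := (Set.finite_range
        (fun x : J × A × A => v x.1 s x.2.1 - v x.1 (s + ε) x.2.2)).bddAbove
      exact ⟨W, fun x => hW ⟨x, rfl⟩⟩
    obtain ⟨K, hK⟩ := exists_nat_ge (W / ε)
    refine ⟨K, ?_⟩
    intro k S f h hS a
    obtain ⟨a0, ha0⟩ := unm k S f h hS
    rcases Nat.eq_zero_or_pos (k a) with h0 | h0
    · omega
    · obtain ⟨j, hj, rfl⟩ := h.2.2 a h0
      have e1 := h.1 j hj a0
      rw [ha0] at e1
      simp only [Nat.cast_zero, mul_zero, add_zero] at e1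
      have e2 := (hv j (f j) s (s + ε * k (f j)) (by
        have : 0 ≤ ε * k (f j) := by positivity
        linarith)).1
      have e3 := hW (j, f j, a0)
      simp only at e3
      have e4 : (k (f j) : ℝ) ≤ W / ε := by
        rw [le_div_iff₀ hε]
        linarith
      exact_mod_cast e4.trans hK
  obtain ⟨K, hK⟩ := hbd
  obtain ⟨k, S, f, hst, hS, hM⟩ := step
    ((Fintype.card A * K) * (Fintype.card J + 1) + Fintype.card J + 1)
  have h1 : ∑ a, k a ≤ Fintype.card A * K := by
    have := Finset.sum_le_card_nsmul Finset.univ k K (fun a _ => hK k S f hst hS a)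
    simpa using this
  have h2 : S.card ≤ Fintype.card J := Finset.card_le_univ S
  have h3 := Nat.mul_le_mul_right (Fintype.card J + 1) h1
  omega

theorem slope_cont {J A : Type} (v : J → ℝ → A → ℝ) (lam : ℝ) (hl : 1 ≤ lam)
    (hv : SlopeB lam v) (j : J) (a : A) : Continuous (fun p => v j p a) := by
  have : LipschitzWith lam.toNNReal (fun p => v j p a) := by
    apply LipschitzWith.of_le_add_mul
    intro p q
    rw [Real.coe_toNNReal lam (by linarith), Real.dist_eq]
    have hd := abs_nonneg (p - q)
    rcases le_total p q with h | h
    · have := (hv j a p q h).2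
      rw [abs_of_nonpos (by linarith)]
      linarith
    · have := (hv j a q p h).1
      nlinarith
  exact this.continuous

theorem ef_exists {J A : Type} [Fintype J] [Fintype A] [Nonempty A] (v : J → ℝ → A → ℝ)
    (lam : ℝ) (hl : 1 ≤ lam) (hv : SlopeB lam v) (hc : Fintype.card J = Fintype.card A) (s : ℝ) :
    ∃ (r : A → ℝ) (f : J → A), Function.Bijective f ∧ (∀ j, Dem v j r (f j)) ∧
      (∀ a, s ≤ r a) ∧ ∃ a, r a = s := by
  classical
  have hpos : ∀ t : ℕ, (0 : ℝ) < 1 / ((t : ℝ) + 1) := fun t => by positivity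
  choose k f hst a0 ha0 using fun t : ℕ => auction v lam hv hc s (1 / ((t : ℝ) + 1)) (hpos t)
  obtain ⟨W, hW⟩ : ∃ W : ℝ, ∀ x : J × A × A, v x.1 s x.2.1 - v x.1 (s + 1) x.2.2 ≤ W := by
    obtain ⟨W, hW⟩ := (Set.finite_range
      (fun x : J × A × A => v x.1 s x.2.1 - v x.1 (s + 1) x.2.2)).bddAbove
    exact ⟨W, fun x => hW ⟨x, rfl⟩⟩
  have hinj : ∀ t, Function.Bijective (f t) := by
    intro t
    rw [Fintype.bijective_iff_injective_and_card]
    refine ⟨?_, hc⟩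
    intro x y hxy
    exact (hst t).2.1 (by simp) (by simp) hxy
  let R : ℕ → A → ℝ := fun t a => s + 1 / ((t : ℝ) + 1) * k t a
  have hRlow : ∀ t a, s ≤ R t a := by
    intro t a
    have : 0 ≤ 1 / ((t : ℝ) + 1) * k t a := by positivity
    simp only [R]
    linarith
  have hRup : ∀ t a, R t a ≤ s + W := by
    intro t a
    obtain ⟨j, rfl⟩ := (hinj t).2 a
    have e1 := (hst t).1 j (Finset.mem_univ j) (a0 t)
    rw [ha0 t] at e1
    simp only [Nat.cast_zero, mul_zero, add_zero] at e1
    have e2 := (hv j (f t j) s (R t (f t j)) (hRlow t _)).1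
    have e3 := hW (j, f t j, a0 t)
    have e4 : 1 / ((t : ℝ) + 1) ≤ 1 := by
      rw [div_le_one (by positivity)]
      have : (0 : ℝ) ≤ t := by positivity
      linarith
    have e5 := (hv j (a0 t) (s + 1 / ((t : ℝ) + 1)) (s + 1) (by linarith)).1
    simp only [R] at e2 ⊢
    simp only at e3
    linarith
  obtain ⟨⟨F, b0⟩, hfib⟩ := Finite.exists_infinite_fiber (fun t : ℕ => (f t, a0 t))
  have hfr : ∃ᶠ t in Filter.atTop, (f t, a0 t) = (F, b0) := by
    rw [Nat.frequently_atTop_iff_infinite]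
    exact Set.infinite_coe_iff.1 hfib
  obtain ⟨φ, hφ, hφ2⟩ := Filter.extraction_of_frequently_atTop hfr
  have hcpt : IsCompact (Set.Icc (fun _ : A => s) (fun _ => s + W)) := isCompact_Icc
  obtain ⟨r, hr, ψ, hψ, hlim⟩ := hcpt.tendsto_subseq (x := fun t => R (φ t))
    (fun t => ⟨fun a => hRlow _ a, fun a => hRup _ a⟩)
  have hlim' : ∀ a, Filter.Tendsto (fun t => R (φ (ψ t)) a) Filter.atTop (nhds (r a)) := by
    intro a
    exact (tendsto_pi_nhds.1 hlim) a
  have hε : Filter.Tendsto (fun t => 1 / (((φ (ψ t) : ℕ) : ℝ) + 1)) Filter.atTop (nhds 0) :=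
    tendsto_one_div_add_atTop_nhds_zero_nat.comp ((hφ.comp hψ).tendsto_atTop)
  have hF : ∀ t, f (φ t) = F := fun t => congrArg Prod.fst (hφ2 t)
  have hb : ∀ t, a0 (φ t) = b0 := fun t => congrArg Prod.snd (hφ2 t)
  refine ⟨r, F, ?_, ?_, fun a => hr.1 a, b0, ?_⟩
  · rw [← hF 0]; exact hinj _
  · intro j b
    have c1 : Filter.Tendsto (fun t => v j (R (φ (ψ t)) b + 1 / (((φ (ψ t) : ℕ) : ℝ) + 1)) b)
        Filter.atTop (nhds (v j (r b) b)) := by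
      have := ((slope_cont v lam hl hv j b).tendsto (r b + 0)).comp ((hlim' b).add hε)
      rw [add_zero] at this
      exact this
    have c2 : Filter.Tendsto (fun t => v j (R (φ (ψ t)) (F j)) (F j))
        Filter.atTop (nhds (v j (r (F j)) (F j))) :=
      ((slope_cont v lam hl hv j (F j)).tendsto _).comp (hlim' (F j))
    refine le_of_tendsto_of_tendsto' c1 c2 ?_
    intro t
    have := (hst (φ (ψ t))).1 j (Finset.mem_univ j) b
    rw [hF] at this
    exact this
  · have : ∀ t, R (φ (ψ t)) b0 = s := by
      intro t
      have h := ha0 (φ (ψ t))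
      rw [hb] at h
      simp [R, h]
    have h2 := hlim' b0
    simp only [this] at h2
    exact (tendsto_nhds_unique h2 tendsto_const_nhds)

theorem sol_min {J A : Type} [Fintype J] [Fintype A] [Nonempty J] (v : J → ℝ → A → ℝ)
    (lam : ℝ) (hl : 1 ≤ lam) (hv : SlopeB lam v) (hc : Fintype.card A = Fintype.card J + 1)
    (s : ℝ) : ∃ r : A → ℝ, Sol v r ∧ (∀ a, s ≤ r a) ∧ ∃ a, r a = s := by
  classical
  have hJ : 0 < Fintype.card J := Fintype.card_pos
  have : Nonempty A := Fintype.card_pos_iff.1 (by omega)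
  have : NeZero (Fintype.card J) := ⟨by omega⟩
  let v' : (J × Fin (Fintype.card A)) → ℝ → (A × Fin (Fintype.card J)) → ℝ :=
    fun x p y => v x.1 p y.1
  have hv' : SlopeB lam v' := fun x y p q h => hv x.1 y.1 p q h
  obtain ⟨r, f, hf, hd, hlow, ⟨a, t⟩, ha⟩ := ef_exists v' lam hl hv' (by simp [mul_comm]) s
  have hle : ∀ a t t', r (a, t) ≤ r (a, t') := by
    intro a t t'
    obtain ⟨x, hx⟩ := hf.2 (a, t)
    have h1 := hd x (a, t')
    rw [hx] at h1
    simp only [v'] at h1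
    by_contra hcon
    push Not at hcon
    have := (hv x.1 a _ _ hcon.le).1
    linarith
  have heq : ∀ a t t', r (a, t) = r (a, t') := fun a t t' => le_antisymm (hle _ _ _) (hle _ _ _)
  refine ⟨fun a => r (a, 0), ?_, fun a => hlow _, a, (heq a 0 t).trans ha⟩
  intro S hS
  set T := Finset.univ.filter (fun a => ∃ j ∈ S, Dem v j (fun a => r (a, 0)) a) with hT
  have hcard : (S ×ˢ (Finset.univ : Finset (Fin (Fintype.card A)))).card ≤
      (T ×ˢ (Finset.univ : Finset (Fin (Fintype.card J)))).card := by
    apply Finset.card_le_card_of_injOn f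
    · intro x hx
      simp only [Finset.coe_product, Set.mem_prod, Finset.mem_coe, Finset.mem_univ, and_true] at hx ⊢
      simp only [hT, Finset.mem_filter, Finset.mem_univ, true_and]
      refine ⟨x.1, hx, ?_⟩
      intro b
      have := hd x (b, 0)
      simp only [v'] at this
      show v x.1 (r (b, 0)) b ≤ v x.1 (r ((f x).1, 0)) (f x).1
      rw [heq (f x).1 0 (f x).2]
      exact this
    · exact hf.1.injOn
  simp only [Finset.card_product, Finset.card_univ, Fintype.card_fin] at hcard
  by_contra hcon
  have h1 : T.card ≤ S.card := by omega
  have h2 := Nat.mul_le_mul_right (Fintype.card J) h1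
  have h3 : 0 < S.card := Finset.card_pos.2 hS
  rw [hc] at hcard
  nlinarith

theorem sol_sum {J A : Type} [Fintype J] [Fintype A] [Nonempty J] (v : J → ℝ → A → ℝ)
    (lam : ℝ) (hl : 1 ≤ lam) (hv : SlopeB lam v) (hc : Fintype.card A = Fintype.card J + 1)
    (m : ℝ) : ∃ r : A → ℝ, Sol v r ∧ ∑ a, r a = m := by
  classical
  have hJ : 0 < Fintype.card J := Fintype.card_pos
  have : Nonempty A := Fintype.card_pos_iff.1 (by omega)
  choose R hsol hlow e he using sol_min v lam hl hv hc
  set C := lam ^ (Fintype.card A) with hC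
  have hC1 : 1 ≤ C := one_le_pow₀ hl
  have hlev : ∀ s s' a b, R s' a - R s a ≤ C * max 0 (R s' b - R s b) := by
    intro s s' a b
    exact level v lam hl hv _ _ b a (hsol s) (sol_demE v _ hc (hsol s') b)
  have hlip : ∀ a, Continuous (fun s => R s a) := by
    intro a
    have : LipschitzWith C.toNNReal (fun s => R s a) := by
      apply LipschitzWith.of_le_add_mul
      intro p q
      rw [Real.coe_toNNReal C (by linarith), Real.dist_eq]
      have h1 := hlev q p a (e p)
      rw [he p] at h1
      have h2 : max 0 (p - R q (e p)) ≤ |p - q| := by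
        apply max_le (abs_nonneg _)
        have := hlow q (e p)
        have := le_abs_self (p - q)
        linarith
      have h3 := mul_le_mul_of_nonneg_left h2 (by linarith : 0 ≤ C)
      linarith
    exact this.continuous
  have hcont : Continuous (fun s => ∑ a, R s a) := continuous_finsetSum _ (fun a _ => hlip a)
  have hAc : (1 : ℝ) ≤ Fintype.card A := by
    have : 1 ≤ Fintype.card A := by omega
    exact_mod_cast this
  have hup : m ≤ ∑ a, R |m| a := by
    have : ∑ a : A, |m| ≤ ∑ a, R |m| a := Finset.sum_le_sum (fun a _ => hlow _ a)
    simp only [Finset.sum_const, Finset.card_univ, nsmul_eq_mul] at this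
    have h1 := le_abs_self m
    nlinarith [abs_nonneg m]
  have hdown : ∃ s, ∑ a, R s a ≤ m := by
    set Z := |m| + |∑ a, R 0 a| with hZ
    have hZ0 : 0 ≤ Z := by positivity
    refine ⟨-(C * Z), ?_⟩
    have h1 : ∀ a, R (-(C * Z)) a ≤ R 0 a - Z := by
      intro a
      have h2 := hlev (-(C * Z)) 0 (e (-(C * Z))) a
      rw [he] at h2
      have h3 := hlow 0 (e (-(C * Z)))
      have h4 : C * Z ≤ C * max 0 (R 0 a - R (-(C * Z)) a) := by linarith
      have h5 : Z ≤ max 0 (R 0 a - R (-(C * Z)) a) := le_of_mul_le_mul_left h4 (by linarith)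
      rcases le_max_iff.1 h5 with h6 | h6
      · have hz : Z = 0 := le_antisymm h6 hZ0
        rw [hz]; simp
      · linarith
    have h2 : ∑ a, R (-(C * Z)) a ≤ ∑ a, (R 0 a - Z) := Finset.sum_le_sum (fun a _ => h1 a)
    rw [Finset.sum_sub_distrib] at h2
    simp only [Finset.sum_const, Finset.card_univ, nsmul_eq_mul] at h2
    have h3 : Z ≤ Fintype.card A * Z := le_mul_of_one_le_left hZ0 hAc
    have h4 := neg_abs_le m
    have h5 := le_abs_self (∑ a, R 0 a)
    linarith
  obtain ⟨s0, hs0⟩ := hdown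
  obtain ⟨s, hs⟩ := mem_range_of_exists_le_of_exists_ge hcont ⟨s0, hs0⟩ ⟨_, hup⟩
  exact ⟨R s, hsol s, hs⟩

theorem deviate {J A : Type} [Fintype J] [Fintype A] (v : J → ℝ → A → ℝ)
    (lam : ℝ) (hv : SlopeB lam v) (hc : Fintype.card A = Fintype.card J + 1)
    (rs : A → ℝ) (hs : Sol v rs) (e o : A) (κ : ℝ) (hκ : 0 < κ) (r : A → ℝ)
    (hsum : ∑ a, r a = ∑ a, rs a) (f : J → A) (hf : Function.Injective f) (hfo : ∀ j, f j ≠ o)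
    (hd : ∀ j, Dem v j r (f j))
    (hne : o ≠ e → r o - rs o ≤ r e - rs e - κ)
    (ho : o ≠ e → ∀ a, r o - rs o ≤ r a - rs a)
    (he : o = e → ∀ a, r o - rs o - κ ≤ r a - rs a) :
    o = e ∧ r e ≤ rs e + κ := by
  classical
  have hsum0 : ∑ a, (r a - rs a) = 0 := by rw [Finset.sum_sub_distrib, hsum, sub_self]
  by_cases h : o = e
  · refine ⟨h, ?_⟩
    subst h
    by_contra hcon
    push Not at hcon
    have : 0 < ∑ a, (r a - rs a) := by
      apply Finset.sum_pos
      · intro a _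
        have := he rfl a
        linarith
      · exact ⟨o, Finset.mem_univ o⟩
    linarith
  · exfalso
    have hne := hne h
    have ho := ho h
    have hneg : r o - rs o < 0 := by
      by_contra hcon
      push Not at hcon
      have : 0 < ∑ a, (r a - rs a) := by
        apply Finset.sum_pos'
        · intro a _
          have := ho a
          linarith
        · exact ⟨e, Finset.mem_univ e, by linarith⟩
      linarith
    obtain ⟨p, hp⟩ : ∃ p, 0 ≤ r p - rs p := by
      by_contra hcon
      push Not at hcon
      have : ∑ a, (r a - rs a) < 0 := Finset.sum_neg (fun a _ => hcon a) ⟨o, Finset.mem_univ o⟩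
      linarith
    set T := Finset.univ.filter (fun a => r a - rs a < 0) with hT
    have h1 := sol_demE v rs hc hs p T (by simp [hT]; linarith)
    have h2 : (Finset.univ.filter (fun j => ∃ a ∈ T, Dem v j rs a)).card ≤ (T.erase o).card := by
      apply Finset.card_le_card_of_injOn f
      · intro j hj
        simp only [Finset.coe_filter, Finset.mem_univ, true_and, Set.mem_ofPred_eq] at hj
        obtain ⟨a, ha, hda⟩ := hj
        simp only [hT, Finset.mem_filter, Finset.mem_univ, true_and] at ha
        simp only [Finset.coe_erase, Set.mem_sdiff, Finset.mem_coe, Set.mem_singleton_iff]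
        refine ⟨?_, hfo j⟩
        simp only [hT, Finset.mem_filter, Finset.mem_univ, true_and]
        by_contra hcon
        push Not at hcon
        have e1 := (hv j (f j) (rs (f j)) (r (f j)) (by linarith)).1
        have e2 := hda (f j)
        have e3 := (hv j a (r a) (rs a) (by linarith)).1
        have e4 := hd j a
        linarith
      · exact hf.injOn
    have h3 : o ∈ T := by simp [hT]; linarith
    rw [Finset.card_erase_of_mem h3] at h2
    have : 0 < T.card := Finset.card_pos.2 ⟨o, h3⟩
    omega

theorem Bset_slope (n : ℕ) (ρbar : ℝ) (f : ℝ → Fin n → ℝ) (hf : f ∈ Bset n ρbar)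
    (a : Fin n) (p q : ℝ) (hpq : p ≤ q) :
    f q a + (q - p) ≤ f p a ∧ f p a ≤ f q a + (1 + ρbar) * (q - p) := by
  obtain ⟨w, bb, rr, hbb, hrr, hrr2, hf⟩ := hf
  rw [hf, hf]
  have h1 : max 0 (p - bb) ≤ max 0 (q - bb) := max_le_max le_rfl (by linarith)
  have h2 : max 0 (q - bb) ≤ max 0 (p - bb) + (q - p) := by
    apply max_le
    · have := le_max_left 0 (p - bb)
      linarith
    · have := le_max_right 0 (p - bb)
      linarith
  have h3 := mul_le_mul_of_nonneg_left h1 hrr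
  have h4 := mul_le_mul_of_nonneg_left h2 hrr
  have h5 := mul_le_mul_of_nonneg_right hrr2 (sub_nonneg.2 hpq)
  constructor <;> nlinarith

theorem one_step (n : ℕ) (ρbar : ℝ) (hρbar : 0 ≤ ρbar) (m : ℝ)
    (D : Set (ℝ → Fin n → ℝ)) (hQD : QLset n ⊆ D) (hDB : D ⊆ Bset n ρbar)
    (g : (Fin n → (ℝ → Fin n → ℝ)) → (Fin n → ℝ) × Equiv.Perm (Fin n))
    (hg : ∀ vp : Fin n → (ℝ → Fin n → ℝ), (∀ k, vp k ∈ D) →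
      (∑ a, (g vp).1 a = m) ∧ EnvyFree n vp (g vp).1 (g vp).2)
    (u : Fin n → ℝ → Fin n → ℝ)
    (hcont : ∀ i a, Continuous fun p => u i p a)
    (hmono : ∀ i a, StrictAnti fun p => u i p a)
    (vp : Fin n → (ℝ → Fin n → ℝ)) (hvp : ∀ k, vp k ∈ D) (i i' : Fin n) (hii : i' ≠ i) (ε : ℝ)
    (heq : ∀ w ∈ D, u i ((g (Function.update vp i w)).1 ((g (Function.update vp i w)).2 i))
              ((g (Function.update vp i w)).2 i) ≤
            u i ((g vp).1 ((g vp).2 i)) ((g vp).2 i) + ε) :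
    ∃ rs : Fin n → ℝ, ∑ a, rs a = m ∧
      (∀ e, u i (rs e) e ≤ u i ((g vp).1 ((g vp).2 i)) ((g vp).2 i) + ε) ∧
      ∀ a, (g vp).1 a - rs a ≤
        (1 + ρbar) ^ n * max 0 ((g vp).1 ((g vp).2 i) - rs ((g vp).2 i)) := by
  classical
  let v : {j : Fin n // j ≠ i} → ℝ → Fin n → ℝ := fun j => vp j
  have hv : SlopeB (1 + ρbar) v := fun j a p q h => Bset_slope n ρbar _ (hDB (hvp j)) a p q h
  have hc : Fintype.card (Fin n) = Fintype.card {j : Fin n // j ≠ i} + 1 := by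
    have h1 := Fintype.card_subtype_compl (fun j : Fin n => j = i)
    have h2 : Fintype.card {j : Fin n // j = i} = 1 := Fintype.card_subtype_eq i
    have h3 : 0 < Fintype.card (Fin n) := Fintype.card_pos_iff.2 ⟨i⟩
    rw [h2] at h1
    have h4 : Fintype.card {j : Fin n // j ≠ i} = Fintype.card (Fin n) - 1 := by
      convert h1
    omega
  have : Nonempty {j : Fin n // j ≠ i} := ⟨⟨i', hii⟩⟩
  obtain ⟨rs, hs, hsum⟩ := sol_sum v (1 + ρbar) (by linarith) hv hc m
  refine ⟨rs, hsum, ?_, ?_⟩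
  · intro e
    have hk : ∀ κ : ℝ, 0 < κ →
        u i (rs e + κ) e ≤ u i ((g vp).1 ((g vp).2 i)) ((g vp).2 i) + ε := by
      intro κ hκ
      let w : ℝ → Fin n → ℝ := fun p a => (rs a + if a = e then κ else 0) - p
      have hw : w ∈ D := hQD ⟨fun a => rs a + if a = e then κ else 0, fun p a => rfl⟩
      have h1 := heq w hw
      have hD : ∀ k, Function.update vp i w k ∈ D := by
        intro k
        by_cases hki : k = i
        · subst hki; rw [Function.update_self]; exact hw
        · rw [Function.update_of_ne hki]; exact hvp k
      obtain ⟨g1, g2⟩ := hg _ hD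
      set r := (g (Function.update vp i w)).1 with hr
      set σ := (g (Function.update vp i w)).2 with hσ
      have hi : ∀ a, w (r a) a ≤ w (r (σ i)) (σ i) := by
        intro a
        have := g2 i (σ.symm a)
        simpa using this
      have hdev := deviate v (1 + ρbar) hv hc rs hs e (σ i) κ hκ r (g1.trans hsum.symm)
        (fun j => σ j) (fun x y h => Subtype.ext (σ.injective h))
        (fun j h => j.2 (σ.injective h))
        (by
          intro j b
          have := g2 j (σ.symm b)
          rw [Function.update_of_ne j.2] at this
          simpa using this)
        (by
          intro hne
          have := hi e
          simp only [w, if_neg hne, if_true] at this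
          linarith)
        (by
          intro hne a
          have := hi a
          simp only [w, if_neg hne] at this
          split_ifs at this <;> linarith)
        (by
          intro hee a
          have := hi a
          simp only [w, if_pos hee] at this
          split_ifs at this <;> linarith)
      obtain ⟨d1, d2⟩ := hdev
      rw [d1] at h1
      exact ((hmono i e).antitone d2).trans h1
    have ht : Filter.Tendsto (fun κ : ℝ => u i (rs e + κ) e) (nhdsWithin 0 (Set.Ioi 0))
        (nhds (u i (rs e) e)) := by
      have h1 : Continuous (fun κ : ℝ => u i (rs e + κ) e) :=
        (hcont i e).comp (continuous_const.add continuous_id)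
      have := h1.tendsto 0
      simp only [add_zero] at this
      exact this.mono_left nhdsWithin_le_nhds
    refine le_of_tendsto ht ?_
    filter_upwards [self_mem_nhdsWithin] with κ hκ
    exact hk κ hκ
  · intro a
    obtain ⟨g1, g2⟩ := hg _ hvp
    have := level v (1 + ρbar) (by linarith) hv (g vp).1 rs ((g vp).2 i) a hs ?_
    · simpa using this
    · intro L hL
      refine Finset.card_le_card_of_surjOn
        (fun j : {j : Fin n // j ≠ i} => (g vp).2 j) ?_
      intro b hb
      have hne : (g vp).2.symm b ≠ i := by
        intro h
        apply hL
        rw [← h]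
        simpa using hb
      refine ⟨⟨(g vp).2.symm b, hne⟩, ?_, by simp⟩
      simp only [Finset.coe_filter, Finset.mem_univ, true_and, Set.mem_ofPred_eq]
      refine ⟨b, hb, ?_⟩
      intro c
      have := g2 ((g vp).2.symm b) ((g vp).2.symm c)
      simpa using this

/-- let `Q ⊆ D ⊆ B` and `g` an envy-free scf on `D^N`. For every
true profile `u` (continuous, money-monotone, compensation), every limit Nash
equilibrium outcome of the direct revelation game `(N, D^N, g, u)` — a limit of
`ε_k`-equilibrium outcomes with `ε_k → 0` — is an envy-free allocation for `u`. -/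
theorem stmt_14 (n : ℕ) (ρbar : ℝ) (hρbar : 0 ≤ ρbar) (m : ℝ)
    (D : Set (ℝ → Fin n → ℝ)) (hQD : QLset n ⊆ D) (hDB : D ⊆ Bset n ρbar)
    (g : (Fin n → (ℝ → Fin n → ℝ)) → (Fin n → ℝ) × Equiv.Perm (Fin n))
    (hg : ∀ vp : Fin n → (ℝ → Fin n → ℝ), (∀ k, vp k ∈ D) →
      (∑ a, (g vp).1 a = m) ∧ EnvyFree n vp (g vp).1 (g vp).2)
    (u : Fin n → ℝ → Fin n → ℝ)
    (hcont : ∀ i a, Continuous fun p => u i p a)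
    (hmono : ∀ i a, StrictAnti fun p => u i p a)
    (hcomp : ∀ i : Fin n, ∀ a c : Fin n, ∀ p : ℝ, ∃ q : ℝ, u i p a = u i q c)
    (z : (Fin n → ℝ) × Equiv.Perm (Fin n))
    (hz : ∃ (vs : ℕ → Fin n → (ℝ → Fin n → ℝ)) (es : ℕ → ℝ),
      (∀ k, 0 < es k) ∧
      Filter.Tendsto es Filter.atTop (nhds 0) ∧
      (∀ k, (∀ i, vs k i ∈ D) ∧
        ∀ i : Fin n, ∀ w ∈ D,
          u i ((g (Function.update (vs k) i w)).1
                ((g (Function.update (vs k) i w)).2 i))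
              ((g (Function.update (vs k) i w)).2 i) ≤
            u i ((g (vs k)).1 ((g (vs k)).2 i)) ((g (vs k)).2 i) + es k) ∧
      Filter.Tendsto (fun k => (g (vs k)).1) Filter.atTop (nhds z.1) ∧
      (∀ᶠ k in Filter.atTop, (g (vs k)).2 = z.2)) :
    (∑ a, z.1 a = m) ∧ EnvyFree n u z.1 z.2 := by
  obtain ⟨vs, es, hes, hes0, heq, hlim, hperm⟩ := hz
  have hlim' : ∀ a, Filter.Tendsto (fun k => (g (vs k)).1 a) Filter.atTop (nhds (z.1 a)) :=
    fun a => (tendsto_pi_nhds.1 hlim) a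
  constructor
  · have h1 : Filter.Tendsto (fun k => ∑ a, (g (vs k)).1 a) Filter.atTop (nhds (∑ a, z.1 a)) :=
      tendsto_finsetSum _ (fun a _ => hlim' a)
    have h2 : (fun k => ∑ a, (g (vs k)).1 a) = fun _ => m := by
      funext k
      exact (hg _ (heq k).1).1
    rw [h2] at h1
    exact tendsto_nhds_unique h1 tendsto_const_nhds
  · intro i j
    by_cases hij : j = i
    · rw [hij]
    choose rs hsum hdev hlev using fun k => one_step n ρbar hρbar m D hQD hDB g hg u hcont hmono
      (vs k) (heq k).1 i j hij (es k) ((heq k).2 i)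
    set a0 := z.2 i with ha0
    set c := z.2 j with hc
    have hU : Filter.Tendsto (fun k => u i ((g (vs k)).1 a0) a0 + es k) Filter.atTop
        (nhds (u i (z.1 a0) a0)) := by
      have := (((hcont i a0).tendsto _).comp (hlim' a0)).add hes0
      rw [add_zero] at this
      exact this
    set C := (1 + ρbar) ^ n with hC
    have hC0 : 0 ≤ C := by positivity
    have main : ∀ δ : ℝ, 0 < δ →
        u i (z.1 c + (δ + n * (C * (2 * δ)))) c ≤ u i (z.1 a0) a0 := by
      intro δ hδ
      refine ge_of_tendsto hU ?_
      have hlt : u i (z.1 a0) a0 < u i (z.1 a0 - δ) a0 := hmono i a0 (by linarith)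
      filter_upwards [hperm, hU.eventually_lt_const hlt,
        (hlim' a0).eventually_lt_const (show z.1 a0 < z.1 a0 + δ by linarith),
        (hlim' c).eventually_lt_const (show z.1 c < z.1 c + δ by linarith)] with k k1 k2 k3 k4
      have d := hdev k
      have l := hlev k
      rw [k1, ← ha0] at d l
      have b1 : z.1 a0 - δ ≤ rs k a0 := by
        by_contra hcon
        push Not at hcon
        have q1 : u i (z.1 a0 - δ) a0 < u i (rs k a0) a0 := hmono i a0 hcon
        have q2 := d a0
        linarith
      have b2 : max 0 ((g (vs k)).1 a0 - rs k a0) ≤ 2 * δ :=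
        max_le (by linarith) (by linarith)
      have b3 : ∀ a, (g (vs k)).1 a - rs k a ≤ C * (2 * δ) :=
        fun a => (l a).trans (mul_le_mul_of_nonneg_left b2 hC0)
      have b4 : ∑ a, ((g (vs k)).1 a - rs k a) = 0 := by
        rw [Finset.sum_sub_distrib, hsum k, (hg _ (heq k).1).1, sub_self]
      have b5 : rs k c - (g (vs k)).1 c ≤ n * (C * (2 * δ)) := by
        rw [← Finset.add_sum_erase _ _ (Finset.mem_univ c)] at b4
        have b6 := Finset.sum_le_card_nsmul (Finset.univ.erase c)
          (fun a => (g (vs k)).1 a - rs k a) (C * (2 * δ)) (fun a _ => b3 a)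
        rw [nsmul_eq_mul] at b6
        have b7 : ((Finset.univ.erase c).card : ℝ) ≤ n := by
          have := Finset.card_le_univ (Finset.univ.erase c)
          rw [Fintype.card_fin] at this
          exact_mod_cast this
        have b8 : 0 ≤ C * (2 * δ) := by positivity
        have b9 := mul_le_mul_of_nonneg_right b7 b8
        linarith
      have b10 : u i (z.1 c + (δ + n * (C * (2 * δ)))) c ≤ u i (rs k c) c :=
        (hmono i c).antitone (by linarith)
      exact b10.trans (d c)
    have ht : Filter.Tendsto (fun δ : ℝ => u i (z.1 c + (δ + n * (C * (2 * δ)))) c)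
        (nhdsWithin 0 (Set.Ioi 0)) (nhds (u i (z.1 c) c)) := by
      have h1 : Continuous (fun δ : ℝ => u i (z.1 c + (δ + n * (C * (2 * δ)))) c) :=
        (hcont i c).comp (by fun_prop)
      have := h1.tendsto 0
      simp only [add_zero, mul_zero] at this
      exact this.mono_left nhdsWithin_le_nhds
    refine le_of_tendsto ht ?_
    filter_upwards [self_mem_nhdsWithin] with δ hδ
    exact main δ hδ
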